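/- Let ρ and σ be positive definite Hermitian d×d complex matrices. Suppose v₁,…,vₙ are vectors in ℂ^d and p₁,…,pₙ, q₁,…,qₙ are reals with pₓ ≥ 0, qₓ > 0, such that Σₓ pₓ vₓvₓ† = ρ, Σₓ qₓ vₓvₓ† = σ, and each vₓ is a unit vector. Then Σₓ pₓ · log(pₓ/qₓ) ≥ Tr(ρ · log(ρ^{1/2} σ⁻¹ ρ^{1/2})). (Any exact reverse estimation of the pair (ρ, σ) has classical divergence at least the RLD divergence D^R(ρ||σ); terms with pₓ = 0 contribute 0.) -/

import Mathlib

open Matrix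
open scoped ComplexOrder

/-- The logarithm of a matrix, via the continuous functional calculus
(for a positive definite Hermitian matrix this is the usual matrix logarithm). -/
noncomputable def matLog {n : Type*} [Fintype n] [DecidableEq n]
    (A : Matrix n n ℂ) : Matrix n n ℂ :=
  cfc Real.log A

/-- The positive square root of a matrix, via the continuous functional calculus
(for a positive semidefinite Hermitian matrix this is the usual positive square root). -/
noncomputable def matSqrt {n : Type*} [Fintype n] [DecidableEq n]
    (A : Matrix n n ℂ) : Matrix n n ℂ :=
  cfc Real.sqrt A

lemma tendsto_sum_mul_log_add_sub_log {ι : Type*} [Fintype ι] (a c : ι → ℝ) :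
    Filter.Tendsto (fun s => ∑ i, a i * (Real.log (s + c i) - Real.log s))
      Filter.atTop (nhds 0) := by
  have h := tendsto_finsetSum (Finset.univ : Finset ι) fun i _ =>
    (Real.tendsto_log_comp_add_sub_log (c i)).const_mul (a i)
  simpa only [mul_zero, Finset.sum_const_zero] using h

/-- If two finite weighted families of positive reals have equal total weight and their resolvent
sums are ordered on `[0, ∞)`, then their weighted logarithmic sums are ordered the other way. -/
lemma sum_mul_log_le_of_sum_div_add_le {ι κ : Type*} [Fintype ι] [Fintype κ]
    (a c : ι → ℝ) (b t : κ → ℝ) (hc : ∀ i, 0 < c i) (ht : ∀ k, 0 < t k)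
    (hab : ∑ i, a i = ∑ k, b k)
    (h : ∀ s, 0 ≤ s → ∑ i, a i / (c i + s) ≤ ∑ k, b k / (t k + s)) :
    ∑ k, b k * Real.log (t k) ≤ ∑ i, a i * Real.log (c i) := by
  set F : ℝ → ℝ := fun s => ∑ i, a i * Real.log (c i + s) - ∑ k, b k * Real.log (t k + s) with hF
  have hderiv : ∀ s, 0 ≤ s →
      HasDerivAt F (∑ i, a i / (c i + s) - ∑ k, b k / (t k + s)) s := by
    intro s hs
    refine HasDerivAt.sub ?_ ?_
    · refine HasDerivAt.fun_sum fun i _ => ?_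
      have := (((hasDerivAt_id s).const_add (c i)).log
        (add_pos_of_pos_of_nonneg (hc i) hs).ne').const_mul (a i)
      simpa [div_eq_mul_inv] using this
    · refine HasDerivAt.fun_sum fun k _ => ?_
      have := (((hasDerivAt_id s).const_add (t k)).log
        (add_pos_of_pos_of_nonneg (ht k) hs).ne').const_mul (b k)
      simpa [div_eq_mul_inv] using this
  have hanti : AntitoneOn F (Set.Ici 0) := by
    refine antitoneOn_of_deriv_nonpos (convex_Ici 0)
      (fun s hs => (hderiv s hs).continuousAt.continuousWithinAt) ?_ ?_
    · intro s hs
      exact (hderiv s (interior_subset hs)).differentiableAt.differentiableWithinAt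
    · intro s hs
      rw [(hderiv s (interior_subset hs)).deriv]
      exact sub_nonpos.mpr (h s (interior_subset hs))
  have hlim : Filter.Tendsto F Filter.atTop (nhds 0) := by
    have hFeq : F = fun s => ∑ i, a i * (Real.log (s + c i) - Real.log s)
        - ∑ k, b k * (Real.log (s + t k) - Real.log s) := by
      funext s
      simp only [hF, mul_sub, Finset.sum_sub_distrib, ← Finset.sum_mul, hab, add_comm s]
      ring
    rw [hFeq]
    simpa only [sub_zero] using
      (tendsto_sum_mul_log_add_sub_log a c).sub (tendsto_sum_mul_log_add_sub_log b t)
  have h0 : 0 ≤ F 0 := le_of_tendsto hlim <| by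
    filter_upwards [Filter.eventually_ge_atTop 0] with s hs
    exact hanti Set.self_mem_Ici hs hs
  simpa [hF] using h0

/-- The trace of a matrix against a function of a Hermitian matrix is the sum of the function over
the eigenvalues, weighted by the diagonal entries in an eigenbasis. -/
lemma Matrix.IsHermitian.trace_mul_cfc {m : Type*} [Fintype m] [DecidableEq m]
    {B : Matrix m m ℂ} (hB : B.IsHermitian) (ρ : Matrix m m ℂ) (f : ℝ → ℝ) :
    (trace (ρ * cfc f B)).re = ∑ j, (((hB.eigenvectorUnitary : Matrix m m ℂ)ᴴ * ρ *
      (hB.eigenvectorUnitary : Matrix m m ℂ)) j j).re * f (hB.eigenvalues j) := by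
  rw [hB.cfc_eq f, Matrix.IsHermitian.cfc, Unitary.conjStarAlgAut_apply, ← mul_assoc,
    trace_mul_comm, ← mul_assoc, ← mul_assoc, star_eq_conjTranspose]
  simp [trace, mul_diagonal]

lemma trace_vecMulVec_self_star {m : Type*} [Fintype m] {v : m → ℂ}
    (hv : ∑ i, ‖v i‖ ^ 2 = 1) : trace (vecMulVec v (star v)) = 1 := by
  rw [← Complex.ofReal_one, ← hv]
  simp [trace, vecMulVec_apply, Complex.mul_conj']

/-- A trace form of the Cauchy–Schwarz inequality: the quadratic functional
`(ρ, τ) ↦ Tr(ρ τ⁻¹ ρ)` is bounded by its classical counterpart in any joint decomposition of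
`ρ` and `τ` into pure states. -/
lemma trace_mul_inv_mul_le_sum_sq_div {m ι : Type*} [Fintype m] [DecidableEq m] [Fintype ι]
    (ρ τ : Matrix m m ℂ) (hρ : ρ.IsHermitian) (hτ : τ.PosDef)
    (v : ι → m → ℂ) (hv : ∀ x, ∑ i, ‖v x i‖ ^ 2 = 1)
    (p r : ι → ℝ) (hr : ∀ x, 0 < r x)
    (hρdec : ∑ x, (p x : ℂ) • vecMulVec (v x) (star (v x)) = ρ)
    (hτdec : ∑ x, (r x : ℂ) • vecMulVec (v x) (star (v x)) = τ) :
    (trace (ρ * τ⁻¹ * ρ)).re ≤ ∑ x, p x ^ 2 / r x := by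
  set V : ι → Matrix m m ℂ := fun x => vecMulVec (v x) (star (v x)) with hV
  set A : Matrix m m ℂ := ρ * τ⁻¹ with hA
  have hAH : Aᴴ = τ⁻¹ * ρ := by
    rw [hA, conjTranspose_mul, hρ.eq, conjTranspose_nonsing_inv, hτ.isHermitian.eq]
  have hdet : IsUnit τ.det := (isUnit_iff_isUnit_det τ).mp hτ.isUnit
  have hVtr : ∀ x, trace (V x) = 1 := fun x => trace_vecMulVec_self_star (hv x)
  have hnonneg : ∀ x, 0 ≤ (r x : ℂ) * trace ((((p x / r x : ℝ) : ℂ) • 1 - A) * V x *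
      (((p x / r x : ℝ) : ℂ) • 1 - A)ᴴ) := by
    intro x
    refine mul_nonneg (by exact_mod_cast (hr x).le) ?_
    exact ((posSemidef_vecMulVec_self_star (v x)).mul_mul_conjTranspose_same _).trace_nonneg
  have hexp : ∀ x, (r x : ℂ) * trace ((((p x / r x : ℝ) : ℂ) • 1 - A) * V x *
      (((p x / r x : ℝ) : ℂ) • 1 - A)ᴴ) = ((p x ^ 2 / r x : ℝ) : ℂ)
        - trace (A * ((p x : ℂ) • V x)) - trace (((p x : ℂ) • V x) * Aᴴ)
        + trace (A * ((r x : ℂ) • V x) * Aᴴ) := by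
    intro x
    have hne : (r x : ℂ) ≠ 0 := by exact_mod_cast (hr x).ne'
    simp only [conjTranspose_sub, conjTranspose_smul, conjTranspose_one, sub_mul, mul_sub,
      smul_mul_assoc, mul_smul_comm, one_mul, mul_one, trace_sub, trace_smul, smul_eq_mul,
      hVtr, Complex.star_def, Complex.conj_ofReal]
    push_cast
    field_simp
    ring
  have hsum := Finset.sum_nonneg fun x (_ : x ∈ Finset.univ) => hnonneg x
  rw [Finset.sum_congr rfl fun x _ => hexp x, Finset.sum_add_distrib, Finset.sum_sub_distrib,
    Finset.sum_sub_distrib, ← trace_sum, ← trace_sum, ← trace_sum, ← Finset.mul_sum,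
    ← Finset.sum_mul, ← Finset.sum_mul, ← Finset.mul_sum, hρdec, hτdec, hAH] at hsum
  have h1 : A * τ * (τ⁻¹ * ρ) = A * ρ := by
    rw [mul_assoc, mul_nonsing_inv_cancel_left _ _ hdet]
  rw [h1, ← mul_assoc ρ, ← hA] at hsum
  have := (Complex.le_def.mp hsum).1
  simp only [← Complex.ofReal_sum, Complex.add_re, Complex.sub_re, Complex.ofReal_re,
    Complex.zero_re] at this
  linarith

lemma matSqrt_isHermitian {m : Type*} [Fintype m] [DecidableEq m] (A : Matrix m m ℂ) :
    (matSqrt A).IsHermitian :=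
  cfc_predicate Real.sqrt A

lemma matSqrt_mul_self {m : Type*} [Fintype m] [DecidableEq m] {A : Matrix m m ℂ}
    (hA : A.PosDef) : matSqrt A * matSqrt A = A := by
  have hsa : IsSelfAdjoint A := hA.isHermitian
  rw [matSqrt, ← cfc_mul Real.sqrt Real.sqrt A]
  conv_rhs => rw [← cfc_id ℝ A]
  refine cfc_congr fun x hx => ?_
  rw [hA.isHermitian.spectrum_real_eq_range_eigenvalues] at hx
  obtain ⟨i, rfl⟩ := hx
  exact Real.mul_self_sqrt (hA.eigenvalues_pos i).le

/-- For `B = ρ^{1/2} σ⁻¹ ρ^{1/2}`, the matrix `(B⁻¹ + s)⁻¹` is `ρ^{1/2} (σ + s ρ)⁻¹ ρ^{1/2}`. -/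
lemma cfc_inv_add_inv_matSqrt_mul {m : Type*} [Fintype m] [DecidableEq m]
    {ρ σ : Matrix m m ℂ} (hρ : ρ.PosDef) (hσ : σ.PosDef)
    (hB : (matSqrt ρ * σ⁻¹ * matSqrt ρ).PosDef) {s : ℝ} (hs : 0 ≤ s) :
    cfc (fun b : ℝ => (b⁻¹ + s)⁻¹) (matSqrt ρ * σ⁻¹ * matSqrt ρ)
      = matSqrt ρ * (σ + (s : ℂ) • ρ)⁻¹ * matSqrt ρ := by
  set R := matSqrt ρ
  set B := R * σ⁻¹ * R with hBdef
  have hRR : R * R = ρ := matSqrt_mul_self hρ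
  have hs' : (0 : ℂ) ≤ s := by exact_mod_cast hs
  have hτ : (σ + (s : ℂ) • ρ).PosDef := hσ.add_posSemidef (hρ.posSemidef.smul hs')
  have hunit : IsUnit (1 + (s : ℂ) • B) :=
    (PosDef.one.add_posSemidef (hB.posSemidef.smul hs')).isUnit
  have hsa : IsSelfAdjoint B := hB.isHermitian
  have hpos : ∀ x ∈ spectrum ℝ B, 0 < x := by
    intro x hx
    rw [hB.isHermitian.spectrum_real_eq_range_eigenvalues] at hx
    obtain ⟨i, rfl⟩ := hx
    exact hB.eigenvalues_pos i
  have hfin : (spectrum ℝ B).Finite := Matrix.finite_real_spectrum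
  refine hunit.mul_right_cancel (Eq.trans (b := B) ?_ ?_)
  · have hlin : cfc (fun b : ℝ => 1 + s * b) B = 1 + (s : ℂ) • B := by
      rw [cfc_const_add 1 (fun b : ℝ => s * b) B, cfc_const_mul_id s B]
      simp
    rw [← hlin, ← cfc_mul _ _ B (hfin.continuousOn _) (hfin.continuousOn _)]
    conv_rhs => rw [← cfc_id ℝ B]
    refine cfc_congr fun x hx => ?_
    have hx0 := hpos x hx
    simp only [id]
    have : 0 < 1 + s * x := by positivity
    have h2 : x⁻¹ + s = (1 + s * x) / x := by field_simp
    rw [h2]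
    field_simp
  · have hσdet : IsUnit σ.det := (isUnit_iff_isUnit_det σ).mp hσ.isUnit
    have hτdet := (isUnit_iff_isUnit_det _).mp hτ.isUnit
    have h1 : 1 + (s : ℂ) • (ρ * σ⁻¹) = (σ + (s : ℂ) • ρ) * σ⁻¹ := by
      rw [add_mul, mul_nonsing_inv _ hσdet, smul_mul_assoc]
    have h2 : R * (1 + (s : ℂ) • B) = (1 + (s : ℂ) • (ρ * σ⁻¹)) * R := by
      rw [hBdef, ← hRR]
      simp only [mul_add, add_mul, mul_one, one_mul, mul_smul_comm, smul_mul_assoc, mul_assoc]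
    rw [mul_assoc, h2, h1, mul_assoc (σ + _), mul_assoc R, nonsing_inv_mul_cancel_left _ _ hτdet,
      hBdef, mul_assoc]

/-- Any exact reverse estimation of the pair `(ρ, σ)` has classical Kullback–Leibler
divergence at least the RLD divergence `Dᴿ(ρ‖σ) = Tr(ρ log(ρ^{1/2} σ⁻¹ ρ^{1/2}))`. -/
theorem reverse_estimation_kl_ge_rldDivergence {d n : ℕ}
    (ρ σ : Matrix (Fin d) (Fin d) ℂ) (hρ : ρ.PosDef) (hσ : σ.PosDef)
    (v : Fin n → (Fin d → ℂ)) (hv : ∀ x, ∑ i, ‖v x i‖ ^ 2 = 1)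
    (p q : Fin n → ℝ) (hp : ∀ x, 0 ≤ p x) (hq : ∀ x, 0 < q x)
    (hρdec : ∑ x, (p x : ℂ) • Matrix.vecMulVec (v x) (star (v x)) = ρ)
    (hσdec : ∑ x, (q x : ℂ) • Matrix.vecMulVec (v x) (star (v x)) = σ) :
    (Matrix.trace (ρ * matLog (matSqrt ρ * σ⁻¹ * matSqrt ρ))).re
      ≤ ∑ x, p x * Real.log (p x / q x) := by
  have hRH := matSqrt_isHermitian ρ
  have hRR := matSqrt_mul_self hρ
  have hRunit : IsUnit (matSqrt ρ) := isUnit_of_mul_isUnit_left (hRR ▸ hρ.isUnit)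
  have hB : (matSqrt ρ * σ⁻¹ * matSqrt ρ).PosDef := by
    have := hσ.inv.conjTranspose_mul_mul_same (B := matSqrt ρ)
      (mulVec_injective_of_isUnit hRunit)
    rwa [hRH.eq] at this
  have hBH := hB.isHermitian
  set B := matSqrt ρ * σ⁻¹ * matSqrt ρ
  set a : Fin d → ℝ := fun j => (((hBH.eigenvectorUnitary : Matrix (Fin d) (Fin d) ℂ)ᴴ * ρ *
      (hBH.eigenvectorUnitary : Matrix (Fin d) (Fin d) ℂ)) j j).re
  have htr : ∀ f : ℝ → ℝ, (trace (ρ * cfc f B)).re = ∑ j, a j * f (hBH.eigenvalues j) :=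
    hBH.trace_mul_cfc ρ
  set t : Fin n → ℝ := fun x => if p x = 0 then 1 else q x / p x with ht
  have htpos : ∀ x, 0 < t x := by
    intro x
    by_cases h : p x = 0
    · simp [ht, h]
    · simpa [ht, h] using div_pos (hq x) ((hp x).lt_of_ne' h)
  have hVtr := fun x => trace_vecMulVec_self_star (hv x)
  have hab : ∑ j, a j = ∑ x, p x := by
    have h1 := htr fun _ => 1
    have hsa : IsSelfAdjoint B := hBH
    rw [cfc_const_one ℝ B, mul_one, ← hρdec] at h1
    simpa [trace_sum, hVtr] using h1.symm
  have hres : ∀ s, 0 ≤ s →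
      ∑ j, a j / ((hBH.eigenvalues j)⁻¹ + s) ≤ ∑ x, p x / (t x + s) := by
    intro s hs
    have hτ : (σ + (s : ℂ) • ρ).PosDef :=
      hσ.add_posSemidef (hρ.posSemidef.smul (by exact_mod_cast hs))
    have h1 := trace_mul_inv_mul_le_sum_sq_div ρ (σ + (s : ℂ) • ρ) hρ.isHermitian hτ v hv p
      (fun x => q x + s * p x)
      (fun x => add_pos_of_pos_of_nonneg (hq x) (mul_nonneg hs (hp x))) hρdec (by
        rw [← hρdec, ← hσdec, Finset.smul_sum, ← Finset.sum_add_distrib]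
        refine Finset.sum_congr rfl fun x _ => ?_
        rw [smul_smul, ← add_smul]
        push_cast
        rfl)
    have h2 := htr fun b => (b⁻¹ + s)⁻¹
    rw [cfc_inv_add_inv_matSqrt_mul hρ hσ hB hs] at h2
    have h3 : trace (ρ * (matSqrt ρ * (σ + (s : ℂ) • ρ)⁻¹ * matSqrt ρ))
        = trace (ρ * (σ + (s : ℂ) • ρ)⁻¹ * ρ) := by
      set T := (σ + (s : ℂ) • ρ)⁻¹
      rw [← mul_assoc, trace_mul_comm, ← mul_assoc, ← mul_assoc, trace_mul_cycle ρ T ρ]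
      have h4 : matSqrt ρ * ρ * matSqrt ρ = ρ * ρ := by
        generalize matSqrt ρ = R at hRR
        simp only [← hRR, mul_assoc]
      rw [h4]
    rw [h3] at h2
    simp only [div_eq_mul_inv (a _)]
    rw [← h2]
    refine h1.trans_eq (Finset.sum_congr rfl fun x _ => ?_)
    by_cases h : p x = 0
    · simp [h]
    · have hpx : 0 < p x := (hp x).lt_of_ne' h
      have hqx := hq x
      have : t x + s = (q x + s * p x) / p x := by
        simp only [ht, h, if_false]
        field_simp
      rw [this, div_div_eq_mul_div, sq]
  have hmain := sum_mul_log_le_of_sum_div_add_le a (fun j => (hBH.eigenvalues j)⁻¹) p t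
    (fun j => inv_pos.mpr (hB.eigenvalues_pos j)) htpos hab hres
  rw [matLog, htr Real.log]
  have hR : ∑ x, p x * Real.log (p x / q x) = -∑ x, p x * Real.log (t x) := by
    rw [← Finset.sum_neg_distrib]
    refine Finset.sum_congr rfl fun x _ => ?_
    by_cases h : p x = 0
    · simp [h]
    · simp only [ht, h, if_false]
      rw [← inv_div, Real.log_inv, mul_neg]
  simp only [Real.log_inv, mul_neg, Finset.sum_neg_distrib] at hmain
  rw [hR]
  linarith
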